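/- Local expansion of the Loewner kernel at the origin: for every r > 0 there exists a function g holomorphic in a neighborhood of 0 such that for all z ≠ 0 in that neighborhood, H(r,z) = 2/z − (2 ζ_r(π)/π)·z + z³·g(z). In particular H(r,z) − 2/z extends holomorphically across 0, with value 0 at 0, first derivative −2 ζ_r(π)/π at 0, and vanishing second derivative at 0. -/

import Mathlib

open Complex

/-- The theta function Θ(r,z) = (1/i)·∑_{n∈ℤ} (−1)^n e^{−r(n+1/2)²} e^{(n+1/2)iz}. -/
noncomputable def Theta (r : ℝ) (z : ℂ) : ℂ :=
  (1 / Complex.I) * ∑' n : ℤ, (-1 : ℂ) ^ n *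
    Complex.exp (-(r : ℂ) * ((n : ℂ) + 1 / 2) ^ 2) *
    Complex.exp (((n : ℂ) + 1 / 2) * Complex.I * z)

/-- The Loewner kernel H(r,z) = 2 Θ′(r,z)/Θ(r,z). -/
noncomputable def Hker (r : ℝ) (z : ℂ) : ℂ := 2 * deriv (Theta r) z / Theta r z

/-- The lattice L_r = 2πℤ + 2irℤ. -/
def ThetaLattice (r : ℝ) : Set ℂ :=
  {z | ∃ m n : ℤ, z = 2 * (Real.pi : ℂ) * m + 2 * Complex.I * r * n}

/-- Lattice point 2πm + 2irn. -/
noncomputable def latPt (r : ℝ) (p : ℤ × ℤ) : ℂ :=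
  2 * (Real.pi : ℂ) * p.1 + 2 * Complex.I * (r : ℂ) * p.2

/-- The Weierstrass zeta function with periods (2π, 2ir). -/
noncomputable def wzeta (r : ℝ) (z : ℂ) : ℂ :=
  1 / z + ∑' p : ℤ × ℤ, if p = 0 then 0 else
    (1 / (z - latPt r p) + 1 / latPt r p + z / latPt r p ^ 2)



lemma theta_term_eq (r : ℝ) (z : ℂ) (n : ℤ) :
    (-1 : ℂ) ^ n * Complex.exp (-(r : ℂ) * ((n : ℂ) + 1 / 2) ^ 2) *
      Complex.exp (((n : ℂ) + 1 / 2) * Complex.I * z) =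
    Complex.exp (-(r:ℂ)/4 + I * z / 2) *
      jacobiTheta₂_term n (1/2 + (z + I * r) / (2 * Real.pi)) (I * r / Real.pi) := by
  have hpi : (Real.pi : ℂ) ≠ 0 := by exact_mod_cast Real.pi_ne_zero
  rw [jacobiTheta₂_term, ← Complex.exp_pi_mul_I, ← Complex.exp_int_mul, ← Complex.exp_add,
    ← Complex.exp_add, ← Complex.exp_add]
  congr 1
  field_simp
  linear_combination (-16 * (r * n ^ 2 + r * n) : ℂ) * I_sq

lemma theta_eq (r : ℝ) (z : ℂ) : Theta r z = (1 / I) * (Complex.exp (-(r:ℂ)/4 + I * z / 2) *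
      jacobiTheta₂ (1/2 + (z + I * r) / (2 * Real.pi)) (I * r / Real.pi)) := by
  rw [Theta, jacobiTheta₂]
  simp_rw [theta_term_eq]
  rw [tsum_mul_left]

lemma tau_im (r : ℝ) (hr : 0 < r) : 0 < (I * r / Real.pi : ℂ).im := by
  have : (I * r / Real.pi : ℂ) = I * ((r / Real.pi : ℝ) : ℂ) := by push_cast; ring
  rw [this]
  simp only [mul_im, I_re, I_im, ofReal_re, ofReal_im]
  have := Real.pi_pos
  simp; positivity

lemma theta_differentiable (r : ℝ) (hr : 0 < r) : Differentiable ℂ (Theta r) := by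
  intro z
  have : Theta r = fun z => (1 / I) * (Complex.exp (-(r:ℂ)/4 + I * z / 2) *
      jacobiTheta₂ (1/2 + (z + I * r) / (2 * Real.pi)) (I * r / Real.pi)) := by
    ext z; exact theta_eq r z
  rw [this]
  refine DifferentiableAt.const_mul (DifferentiableAt.mul (by fun_prop) ?_) _
  exact (differentiableAt_jacobiTheta₂_fst _ (tau_im r hr)).comp z
    (f := fun z : ℂ => 1/2 + (z + I * r) / (2 * Real.pi)) (by fun_prop)

lemma theta_add_two_pi (r : ℝ) (z : ℂ) : Theta r (z + 2 * Real.pi) = - Theta r z := by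
  have hpi : (Real.pi : ℂ) ≠ 0 := by exact_mod_cast Real.pi_ne_zero
  rw [theta_eq, theta_eq]
  have h1 : (1/2 + (z + 2 * Real.pi + I * r) / (2 * Real.pi) : ℂ)
    = (1/2 + (z + I * r) / (2 * Real.pi)) + 1 := by field_simp; ring
  have h2 : (-(r:ℂ)/4 + I * (z + 2 * Real.pi) / 2) = (-(r:ℂ)/4 + I * z / 2) + Real.pi * I := by ring
  rw [h1, jacobiTheta₂_add_left, h2, Complex.exp_add, Complex.exp_pi_mul_I]
  ring

lemma theta_add_ir (r : ℝ) (z : ℂ) :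
    Theta r (z + 2 * I * r) = - Complex.exp (r - I * z) * Theta r z := by
  have hpi : (Real.pi : ℂ) ≠ 0 := by exact_mod_cast Real.pi_ne_zero
  rw [theta_eq, theta_eq]
  have h1 : (1/2 + (z + 2 * I * r + I * r) / (2 * Real.pi) : ℂ)
    = (1/2 + (z + I * r) / (2 * Real.pi)) + I * r / Real.pi := by field_simp; ring
  rw [h1, jacobiTheta₂_add_left']
  have key : Complex.exp (-(r:ℂ)/4 + I * (z + 2 * I * r) / 2) *
      Complex.exp (-Real.pi * I * (I * r / Real.pi + 2 * (1/2 + (z + I * r) / (2 * Real.pi))))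
      = -Complex.exp (r - I * z) * Complex.exp (-(r:ℂ)/4 + I * z / 2) := by
    rw [← Complex.exp_add]
    have : (-(r:ℂ)/4 + I * (z + 2 * I * r) / 2 + -Real.pi * I * (I * r / Real.pi + 2 * (1/2 + (z + I * r) / (2 * Real.pi)))) = (r - I * z) + (-(r:ℂ)/4 + I * z / 2) - Real.pi * I := by
      field_simp
      linear_combination (-8 * r : ℂ) * I_sq
    rw [this, Complex.exp_sub, Complex.exp_add, Complex.exp_pi_mul_I]
    ring
  linear_combination (1 / I) * jacobiTheta₂ (1/2 + (z + I * r) / (2 * Real.pi)) (I * r / Real.pi) * key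

lemma theta_neg (r : ℝ) (z : ℂ) : Theta r (-z) = - Theta r z := by
  rw [Theta, Theta, ← mul_neg, ← tsum_neg]
  congr 1
  rw [← (Equiv.subLeft (-1 : ℤ)).tsum_eq]
  refine tsum_congr fun n => ?_
  have h : (-1 : ℂ) ^ (-1 - n : ℤ) = - (-1) ^ n := by
    rw [zpow_sub₀ (by norm_num)]
    rcases Int.even_or_odd n with h | h
    · simp [h.neg_one_zpow]
    · simp [h.neg_one_zpow]
  simp only [Equiv.subLeft_apply]
  rw [h, ← neg_mul, ← neg_mul]
  push_cast
  congr 2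
  · congr 1; congr 1; ring
  · ring

lemma theta_pi_ne (r : ℝ) (hr : 0 < r) : Theta r Real.pi ≠ 0 := by
  have hs : Summable fun n : ℤ => (-1 : ℂ) ^ n * Complex.exp (-(r : ℂ) * ((n : ℂ) + 1 / 2) ^ 2) *
      Complex.exp (((n : ℂ) + 1 / 2) * Complex.I * Real.pi) := by
    simp_rw [theta_term_eq]
    exact ((summable_jacobiTheta₂_term_iff _ _).2 (tau_im r hr)).mul_left _
  have ht : ∀ n : ℤ, (-1 : ℂ) ^ n * Complex.exp (-(r : ℂ) * ((n : ℂ) + 1 / 2) ^ 2) *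
      Complex.exp (((n : ℂ) + 1 / 2) * Complex.I * Real.pi) =
      I * ((Real.exp (-r * (n + 1/2)^2) : ℝ) : ℂ) := by
    intro n
    have : (((n : ℂ) + 1 / 2) * Complex.I * Real.pi) = n * (Real.pi * I) + Real.pi / 2 * I := by ring
    rw [this, Complex.exp_add, Complex.exp_int_mul, Complex.exp_pi_mul_I, Complex.exp_pi_div_two_mul_I]
    have : (-1 : ℂ) ^ n * (-1) ^ n = 1 := by rw [← mul_zpow]; simp
    push_cast
    linear_combination (I * Complex.exp (-(r : ℂ) * ((n : ℂ) + 1 / 2) ^ 2)) * this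
  simp_rw [ht] at hs
  have hs2 := (summable_mul_left_iff I_ne_zero).1 hs
  rw [Complex.summable_ofReal] at hs2
  have hpos := hs2.tsum_pos (fun n => (Real.exp_pos _).le) 0 (Real.exp_pos _)
  rw [Theta]
  simp_rw [ht]
  rw [tsum_mul_left, ← Complex.ofReal_tsum]
  have := hpos.ne'
  simp only [ne_eq, mul_eq_zero, not_or]
  refine ⟨by simp, I_ne_zero, by exact_mod_cast this⟩

noncomputable def LL (r : ℝ) (hr : 0 < r) : PeriodPair where
  ω₁ := 2 * Real.pi
  ω₂ := 2 * I * r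
  indep := by
    rw [LinearIndependent.pair_iff]
    intro s t h
    have h1 := congrArg Complex.re h
    have h2 := congrArg Complex.im h
    simp at h1 h2
    exact ⟨h1, h2.resolve_right hr.ne'⟩

def UU (r : ℝ) : Set ℂ :=
  Set.Ioo (-(3 * Real.pi / 2)) (3 * Real.pi / 2) ×ℂ Set.Ioo (-(3 * r / 2)) (3 * r / 2)

lemma mem_UU {r : ℝ} {z : ℂ} : z ∈ UU r ↔ |z.re| < 3 * Real.pi / 2 ∧ |z.im| < 3 * r / 2 := by
  simp [UU, mem_reProdIm, abs_lt]

lemma isOpen_UU (r : ℝ) : IsOpen (UU r) := isOpen_Ioo.reProdIm isOpen_Ioo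

lemma convex_UU (r : ℝ) : Convex ℝ (UU r) := 
  ((convex_Ioo _ _).linear_preimage Complex.reLm).inter ((convex_Ioo _ _).linear_preimage Complex.imLm)

lemma zero_mem_UU {r : ℝ} (hr : 0 < r) : (0 : ℂ) ∈ UU r := by
  have := Real.pi_pos
  rw [mem_UU]; simp; constructor <;> positivity

lemma aux_abs {ω x : ℝ} (hx : |x| < 3 * ω / 4) (m : ℤ) : |ω * m| ≤ 4 * |x - ω * m| := by
  have hω : 0 < ω := by have := abs_nonneg x; linarith
  rcases eq_or_ne m 0 with rfl | hm
  · simp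
  have h1 : (1 : ℝ) ≤ |(m : ℝ)| := by exact_mod_cast Int.one_le_abs hm
  have h2 : |ω * m| = ω * |(m : ℝ)| := by rw [abs_mul, abs_of_pos hω]
  have h3 : |ω * m| ≤ |x| + |x - ω * m| := by
    have := abs_sub_abs_le_abs_sub (ω * m) x
    rw [abs_sub_comm] at this
    linarith
  nlinarith

lemma latPt_re (r : ℝ) (p : ℤ × ℤ) : (latPt r p).re = (2 * Real.pi) * p.1 := by
  simp [latPt]
lemma latPt_im (r : ℝ) (p : ℤ × ℤ) : (latPt r p).im = (2 * r) * p.2 := by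
  simp [latPt]

lemma latPt_ne {r : ℝ} (hr : 0 < r) {p : ℤ × ℤ} (hp : p ≠ 0) : latPt r p ≠ 0 := by
  intro h
  apply hp
  have h1 := latPt_re r p
  have h2 := latPt_im r p
  rw [h] at h1 h2
  simp [Real.pi_ne_zero, hr.ne'] at h1 h2
  exact Prod.ext h1 h2

lemma latPt_bound {r : ℝ} {z : ℂ} (hz : z ∈ UU r) (p : ℤ × ℤ) :
    ‖latPt r p‖ ≤ 4 * ‖z - latPt r p‖ := by
  rw [mem_UU] at hz
  have h1 := aux_abs (ω := 2 * Real.pi) (x := z.re) (by linarith [hz.1]) p.1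
  have h2 := aux_abs (ω := 2 * r) (x := z.im) (by linarith [hz.2]) p.2
  rw [← latPt_re r p, ← sub_re] at h1
  rw [← latPt_im r p, ← sub_im] at h2
  refine abs_le_of_sq_le_sq' ?_ (by positivity) |>.2
  rw [mul_pow, Complex.sq_norm, Complex.sq_norm, normSq_apply, normSq_apply]
  have h3 := pow_le_pow_left₀ (abs_nonneg _) h1 2
  have h4 := pow_le_pow_left₀ (abs_nonneg _) h2 2
  rw [mul_pow, sq_abs, sq_abs] at h3 h4
  nlinarith

lemma LL_symm {r : ℝ} (hr : 0 < r) (p : ℤ × ℤ) :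
    (((LL r hr).latticeEquivProd.symm p : (LL r hr).lattice) : ℂ) = latPt r p := by
  rw [PeriodPair.latticeEquiv_symm_apply]
  simp only [LL, latPt]
  ring

lemma summable_latPt {r : ℝ} (hr : 0 < r) : Summable fun p : ℤ × ℤ => (‖latPt r p‖ ^ 3)⁻¹ := by
  have h := ((LL r hr).hasSum_sumInvPow 0 (r := 3) (by norm_num)).summable.norm
  rw [← (LL r hr).latticeEquivProd.symm.toEquiv.summable_iff] at h
  refine h.congr fun p => ?_
  simp [LL_symm]

noncomputable def wz0 (r : ℝ) (z : ℂ) : ℂ := ∑' p : ℤ × ℤ, if p = 0 then 0 else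
    (1 / (z - latPt r p) + 1 / latPt r p + z / latPt r p ^ 2)

lemma wz0_zero (r : ℝ) : wz0 r 0 = 0 := by
  rw [wz0]
  convert tsum_zero with p
  simp

lemma UU_sub_ne {r : ℝ} (hr : 0 < r) {z : ℂ} (hz : z ∈ UU r) {p : ℤ × ℤ} (hp : p ≠ 0) :
    z - latPt r p ≠ 0 := by
  intro h
  have := latPt_bound hz p
  rw [h] at this
  simp [latPt_ne hr hp] at this

lemma wz0_hasDerivAt {r : ℝ} (hr : 0 < r) {z : ℂ} (hz : z ∈ UU r) :
    HasDerivAt (wz0 r) (-(LL r hr).weierstrassPExcept 0 z) z := by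
  have hP : -(LL r hr).weierstrassPExcept 0 z = ∑' p : ℤ × ℤ, if p = 0 then 0 else
      (-1 / (z - latPt r p) ^ 2 + 1 / latPt r p ^ 2) := by
    rw [PeriodPair.weierstrassPExcept, ← (LL r hr).latticeEquivProd.symm.toEquiv.tsum_eq, ← tsum_neg]
    refine tsum_congr fun p => ?_
    simp only [LinearEquiv.coe_toEquiv, LL_symm]
    rcases eq_or_ne p 0 with rfl | hp
    · simp [latPt]
    · rw [if_neg (latPt_ne hr hp), if_neg hp]; ring
  rw [hP]
  refine hasDerivAt_tsum_of_isPreconnected (t := UU r)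
    (g := fun p z => if p = 0 then 0 else (1 / (z - latPt r p) + 1 / latPt r p + z / latPt r p ^ 2))
    (g' := fun p z => if p = 0 then 0 else (-1 / (z - latPt r p) ^ 2 + 1 / latPt r p ^ 2))
    ((summable_latPt hr).mul_left (20 * (3 * Real.pi / 2 + 3 * r / 2)))
    (isOpen_UU r) (convex_UU r).isPreconnected ?_ ?_ (zero_mem_UU hr) ?_ hz
  · intro p y hy
    rcases eq_or_ne p 0 with rfl | hp
    · simpa using hasDerivAt_const y (0:ℂ)
    · simp only [if_neg hp]
      have h1 := (((hasDerivAt_id y).sub_const (latPt r p)).fun_inv (UU_sub_ne hr hy hp))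
      have h2 := (h1.add_const (1 / latPt r p)).add ((hasDerivAt_id y).div_const (latPt r p ^ 2))
      convert h2 using 1
      · ext w; simp
      · simp
  · intro p y hy
    rcases eq_or_ne p 0 with rfl | hp
    · simp [latPt]
    · simp only [if_neg hp]
      have hl := latPt_ne hr hp
      have hd := UU_sub_ne hr hy hp
      have hb := latPt_bound hy p
      have e : (-1 / (y - latPt r p) ^ 2 + 1 / latPt r p ^ 2)
        = y * ((y - latPt r p) - latPt r p) / (latPt r p ^ 2 * (y - latPt r p) ^ 2) := by
        field_simp; ring
      have hy1 : ‖y‖ ≤ 3 * Real.pi / 2 + 3 * r / 2 := by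
        have := Complex.norm_le_abs_re_add_abs_im y
        rw [mem_UU] at hy
        linarith [hy.1, hy.2]
      have hn := norm_sub_le (y - latPt r p) (latPt r p)
      rw [e, norm_div, norm_mul, norm_mul, norm_pow, norm_pow]
      have ha : 0 < ‖latPt r p‖ := norm_pos_iff.2 hl
      have hbb : 0 < ‖y - latPt r p‖ := norm_pos_iff.2 hd
      set a := ‖latPt r p‖
      set b := ‖y - latPt r p‖
      set R := 3 * Real.pi / 2 + 3 * r / 2
      have hR : 0 ≤ R := (norm_nonneg y).trans hy1
      rw [div_le_iff₀ (by positivity)]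
      have : 20 * R * (a ^ 3)⁻¹ * (a ^ 2 * b ^ 2) = 20 * R * b ^ 2 / a := by field_simp
      rw [this, le_div_iff₀ ha]
      calc ‖y‖ * ‖y - latPt r p - latPt r p‖ * a ≤ R * (5 * b) * (4 * b) := by
            gcongr; linarith
        _ = _ := by ring
  · convert summable_zero with p
    simp

lemma LL_compl {r : ℝ} (hr : 0 < r) {z : ℂ} (hz : z ∈ UU r) :
    z ∈ (((LL r hr).lattice : Set ℂ) \ {0})ᶜ := by
  rintro ⟨h1, h2⟩
  have : z = latPt r ((LL r hr).latticeEquivProd ⟨z, h1⟩) := by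
    rw [← LL_symm hr]; simp
  rcases eq_or_ne ((LL r hr).latticeEquivProd ⟨z, h1⟩) 0 with h | h
  · rw [h] at this; apply h2; simpa [latPt] using this
  · exact UU_sub_ne hr hz h (sub_eq_zero.2 this)

lemma P0_analytic {r : ℝ} (hr : 0 < r) :
    AnalyticOnNhd ℂ ((LL r hr).weierstrassPExcept 0) (UU r) :=
  ((LL r hr).analyticOnNhd_weierstrassPExcept 0).mono fun _ hz => LL_compl hr hz

lemma P0_eq {r : ℝ} (hr : 0 < r) (z : ℂ) :
    (LL r hr).weierstrassPExcept 0 z + 1 / z ^ 2 = (LL r hr).weierstrassP z := by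
  simpa using (LL r hr).weierstrassPExcept_add 0 z

lemma P_add {r : ℝ} (hr : 0 < r) (z : ℂ) :
    (LL r hr).weierstrassP (z + 2 * Real.pi) = (LL r hr).weierstrassP z :=
  (LL r hr).weierstrassP_add_coe z ⟨_, (LL r hr).ω₁_mem_lattice⟩

lemma P_add' {r : ℝ} (hr : 0 < r) (z : ℂ) :
    (LL r hr).weierstrassP (z + 2 * I * r) = (LL r hr).weierstrassP z :=
  (LL r hr).weierstrassP_add_coe z ⟨_, (LL r hr).ω₂_mem_lattice⟩

lemma fourier_zero_aux {r : ℝ} (hr : 0 < r) {F : ℂ → ℂ} (hF : DifferentiableOn ℂ F (UU r))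
    (hper : ∀ y : ℝ, |y| ≤ r → F (Real.pi + y * I) = F (-Real.pi + y * I))
    (hq : ∀ x : ℝ, |x| ≤ Real.pi → F (x + r * I) = Complex.exp (-2 * I * x) * F (x + (-r : ℝ) * I))
    (h0 : F 0 = 0) (hpi : F Real.pi = 0) (x : ℝ) (hx : x ∈ Set.Ico (-Real.pi) Real.pi) :
    F x = 0 := by
  have hπ := Real.pi_pos
  set J : ℤ → ℝ → ℂ := fun n y =>
    ∫ x : ℝ in (-Real.pi)..Real.pi, F (x + y * I) * Complex.exp (-I * n * x) with hJ
  have hshift : ∀ (n : ℤ) (y : ℝ), |y| ≤ r → Complex.exp (n * y) * J n y = J n 0 := by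
    intro n y hy
    have hG : DifferentiableOn ℂ (fun z => F z * Complex.exp (-I * n * z)) (UU r) :=
      hF.mul (by fun_prop)
    have hrect := integral_boundary_rect_eq_zero_of_differentiableOn
      (fun z => F z * Complex.exp (-I * n * z)) (-Real.pi + y * I) (Real.pi + 0 * I) (hG.mono (by
        intro z hz
        rw [mem_reProdIm] at hz
        rw [mem_UU]
        obtain ⟨h1, h2⟩ := hz
        simp only [add_re, neg_re, ofReal_re, mul_re, I_re, mul_zero, ofReal_im, I_im, mul_one,
          sub_self, add_zero, add_im, neg_im, neg_zero, mul_im, zero_add, zero_re, zero_im, zero_mul] at h1 h2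
        have h1' := Set.abs_sub_left_of_mem_uIcc h1
        have h2' := Set.abs_sub_right_of_mem_uIcc h2
        rw [Set.uIcc_of_le (by linarith), Set.mem_Icc] at h1
        have : |z.re| ≤ Real.pi := abs_le.2 h1
        constructor
        · linarith
        · simp at h2'; linarith))
    simp only [add_re, neg_re, ofReal_re, mul_re, I_re, mul_zero, ofReal_im, I_im, mul_one,
          sub_self, add_zero, add_im, neg_im, neg_zero, mul_im, zero_add, zero_re, zero_im, zero_mul] at hrect
    have hside : ∫ t : ℝ in y..0, F (Real.pi + t * I) * Complex.exp (-I * n * (Real.pi + t * I))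
      = ∫ t : ℝ in y..0, F (((-Real.pi : ℝ) : ℂ) + t * I) * Complex.exp (-I * n * (((-Real.pi : ℝ) : ℂ) + t * I)) := by
      refine intervalIntegral.integral_congr fun t ht => ?_
      have ht' := Set.abs_sub_right_of_mem_uIcc ht
      simp only [zero_sub, abs_neg] at ht'
      rw [hper t (ht'.trans hy)]
      push_cast
      congr 1
      rw [show -I * n * (Real.pi + t * I) = -I * n * (-Real.pi + t * I) - n * (2 * Real.pi * I) by ring,
        Complex.exp_sub, Complex.exp_int_mul_two_pi_mul_I, div_one]
    rw [hside, add_sub_cancel_right, sub_eq_zero] at hrect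
    rw [hJ]
    simp only
    rw [← intervalIntegral.integral_const_mul]
    convert hrect using 1
    · refine intervalIntegral.integral_congr fun t ht => ?_
      rw [mul_left_comm, ← Complex.exp_add]
      congr 2
      linear_combination (n * y : ℂ) * I_sq
    · simp
  have hrec : ∀ n : ℤ, J (n + 2) 0 = Complex.exp (-(2 * n + 2) * r) * J n 0 := by
    intro n
    have h1 := hshift n r (abs_of_pos hr).le
    have h2 := hshift (n + 2) (-r) (by rw [abs_neg, abs_of_pos hr])
    have h3 : J n r = J (n + 2) (-r) := by
      refine intervalIntegral.integral_congr fun t ht => ?_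
      rw [Set.uIcc_of_le (by linarith), Set.mem_Icc] at ht
      rw [hq t (abs_le.2 ht), mul_comm (Complex.exp _), mul_assoc, ← Complex.exp_add]
      congr 2
      push_cast; ring
    rw [← h1, ← h2, h3, ← mul_assoc, ← Complex.exp_add]
    congr 2
    push_cast; ring
  set A : ℤ → ℂ := fun n => Complex.exp (r * n ^ 2 / 2) * J n 0 with hA
  have hAper : Function.Periodic A 2 := by
    intro n
    simp only [hA, hrec]
    rw [← mul_assoc, ← Complex.exp_add]
    congr 2
    push_cast; ring
  set e : ℤ → ℝ := fun n => Real.exp (-r * n ^ 2 / 2) with he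
  have hJA : ∀ n, J n 0 = A n * (e n : ℂ) := by
    intro n
    simp only [hA, he]
    push_cast
    rw [mul_right_comm, ← Complex.exp_add]
    rw [show (r * n ^ 2 / 2 + -r * n ^ 2 / 2 : ℂ) = 0 by ring]; simp
  have hes : Summable e := by
    have := summable_pow_mul_jacobiTheta₂_term_bound 0 (T := r / (2 * Real.pi)) (by positivity) 0
    refine this.congr fun n => ?_
    simp only [he, pow_zero, one_mul]
    congr 1; field_simp; ring
  have hA0 : ∀ n, Even n → A n = A 0 := by
    rintro n ⟨k, rfl⟩
    have := hAper.int_mul k 0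
    rw [← this]; congr 1; push_cast; ring
  have hA1 : ∀ n, Odd n → A n = A 1 := by
    rintro n ⟨k, rfl⟩
    have := hAper.int_mul k 1
    rw [← this]; congr 1; push_cast; ring
  have : Fact (0 < 2 * Real.pi) := ⟨by positivity⟩
  have hcont : ContinuousOn (fun x : ℝ => F x) (Set.Icc (-Real.pi) (-Real.pi + 2 * Real.pi)) := by
    refine hF.continuousOn.comp (by fun_prop) ?_
    intro t ht
    rw [Set.mem_Icc] at ht
    rw [mem_UU]
    simp only [ofReal_re, ofReal_im, abs_zero]
    refine ⟨?_, by positivity⟩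
    have : |t| ≤ Real.pi := abs_le.2 ⟨ht.1, by linarith⟩
    linarith
  have hend : F ((-Real.pi : ℝ) : ℂ) = F ((-Real.pi + 2 * Real.pi : ℝ) : ℂ) := by
    have := hper 0 (by simpa using hr.le)
    simp at this
    push_cast
    rw [← this]; congr 1; ring
  set f : C(AddCircle (2 * Real.pi), ℂ) :=
    ⟨AddCircle.liftIco (2 * Real.pi) (-Real.pi) (fun x : ℝ => F x),
      AddCircle.liftIco_continuous hend hcont⟩ with hf
  have hcoef : ∀ n, fourierCoeff f n = (1 / (2 * Real.pi) : ℂ) * (A n * e n) := by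
    intro n
    have : fourierCoeff f n = fourierCoeff (AddCircle.liftIco (2 * Real.pi) (-Real.pi) (fun x : ℝ => F x)) n := rfl
    rw [this, fourierCoeff_liftIco_eq, fourierCoeffOn_eq_integral, ← hJA, hJ]
    simp only [real_smul]
    push_cast
    rw [show (-Real.pi + 2 * Real.pi : ℝ) = Real.pi by ring]
    congr 1
    · congr 1; ring
    · refine intervalIntegral.integral_congr fun t ht => ?_
      simp only [fourier_coe_apply, smul_eq_mul]
      rw [mul_comm]
      congr 1
      · simp
      · congr 1
        have : (Real.pi : ℂ) ≠ 0 := by exact_mod_cast hπ.ne'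
        push_cast
        rw [show (Real.pi - -Real.pi : ℂ) = 2 * Real.pi by ring]
        field_simp
  have hsum : Summable (fourierCoeff f) := by
    have hb : ∀ n, ‖A n‖ ≤ ‖A 0‖ + ‖A 1‖ := by
      intro n
      rcases Int.even_or_odd n with h | h
      · rw [hA0 n h]; linarith [norm_nonneg (A 1)]
      · rw [hA1 n h]; linarith [norm_nonneg (A 0)]
    refine Summable.of_norm_bounded ((hes.mul_left (‖A 0‖ + ‖A 1‖)).mul_left (1 / (2 * Real.pi))) ?_
    intro n
    rw [hcoef, norm_mul, norm_mul]
    have h1 : ‖(e n : ℂ)‖ = e n := by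
      rw [norm_real, Real.norm_of_nonneg (Real.exp_pos _).le]
    have h2 : ‖(1 / (2 * Real.pi) : ℂ)‖ = 1 / (2 * Real.pi) := by
      simp [abs_of_pos hπ]
    rw [h1, h2]
    have := Real.exp_pos (-r * n ^ 2 / 2)
    gcongr
    exact hb n
  have hpt : ∀ t : ℝ, t ∈ Set.Ico (-Real.pi) Real.pi →
      HasSum (fun n : ℤ => (1 / (2 * Real.pi) : ℂ) * (A n * e n) * Complex.exp (I * n * t)) (F t) := by
    intro t ht
    have := has_pointwise_sum_fourier_series_of_summable hsum (t : AddCircle (2 * Real.pi))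
    have h2 : f (t : AddCircle (2 * Real.pi)) = F t := by
      simp only [hf, ContinuousMap.coe_mk]
      rw [AddCircle.liftIco_coe_apply]
      rw [show (-Real.pi + 2 * Real.pi : ℝ) = Real.pi by ring]; exact ht
    rw [h2] at this
    convert this using 2 with n
    rw [hcoef, fourier_coe_apply, smul_eq_mul]
    congr 2
    have : (Real.pi : ℂ) ≠ 0 := by exact_mod_cast hπ.ne'
    push_cast
    field_simp
  have hs0 := hpt 0 ⟨by linarith, hπ⟩
  have hsπ := hpt (-Real.pi) ⟨le_refl _, by linarith⟩
  have hFm : F ((-Real.pi : ℝ) : ℂ) = 0 := by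
    rw [hend, show (-Real.pi + 2 * Real.pi : ℝ) = Real.pi by ring]; exact hpi
  rw [hFm] at hsπ
  rw [ofReal_zero, h0] at hs0
  have hexp : ∀ n : ℤ, Complex.exp (I * n * ((-Real.pi : ℝ) : ℂ)) = (-1) ^ n := by
    intro n
    push_cast
    rw [show I * n * -(Real.pi : ℂ) = (n : ℂ) * (-(Real.pi * I)) by ring, Complex.exp_int_mul,
      Complex.exp_neg, Complex.exp_pi_mul_I]
    norm_num
  simp only [hexp] at hsπ
  simp only [ofReal_zero, mul_zero, Complex.exp_zero, mul_one] at hs0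
  have hsub : ∀ S : Set ℤ, S.Nonempty → (∑' n, S.indicator e n) ≠ 0 := by
    rintro S ⟨m, hm⟩
    refine ((hes.indicator S).tsum_pos (fun n => Set.indicator_nonneg (fun _ _ => (Real.exp_pos _).le) n) m ?_).ne'
    rw [Set.indicator_of_mem hm]; exact Real.exp_pos _
  have hπc : (Real.pi : ℂ) ≠ 0 := by exact_mod_cast hπ.ne'
  have hz0 : A 0 = 0 := by
    have h1 := hs0.add hsπ
    have h2 : HasSum (fun n : ℤ => (A 0 / Real.pi) * ((({n : ℤ | Even n}.indicator e n : ℝ)) : ℂ)) 0 := by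
      convert h1 using 2 with n
      · rcases Int.even_or_odd n with h | h
        · rw [Set.indicator_of_mem (by exact h), hA0 n h, h.neg_one_zpow]; field_simp; ring
        · rw [Set.indicator_of_notMem (by simpa using h), h.neg_one_zpow]; simp
      · simp
    have h3 := h2.tsum_eq
    rw [tsum_mul_left, ← Complex.ofReal_tsum] at h3
    rcases mul_eq_zero.1 h3 with h | h
    · simpa [hπc] using h
    · exact absurd (by exact_mod_cast h) (hsub _ ⟨0, by simp⟩)
  have hz1 : A 1 = 0 := by
    have h1 := hs0.sub hsπ
    have h2 : HasSum (fun n : ℤ => (A 1 / Real.pi) * ((({n : ℤ | Odd n}.indicator e n : ℝ)) : ℂ)) 0 := by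
      rw [sub_zero] at h1
      have h4 : (fun n : ℤ => (A 1 / Real.pi) * ((({n : ℤ | Odd n}.indicator e n : ℝ)) : ℂ)) = fun b => 1 / (2 * ↑Real.pi) * (A b * ↑(e b)) - 1 / (2 * ↑Real.pi) * (A b * ↑(e b)) * (-1) ^ b := by
        ext n
        rcases Int.even_or_odd n with h | h
        · rw [Set.indicator_of_notMem (by simpa using h), h.neg_one_zpow]; simp
        · rw [Set.indicator_of_mem (by exact h), hA1 n h, h.neg_one_zpow]; field_simp; ring
      rw [h4]; exact h1
    have h3 := h2.tsum_eq
    rw [tsum_mul_left, ← Complex.ofReal_tsum] at h3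
    rcases mul_eq_zero.1 h3 with h | h
    · simpa [hπc] using h
    · exact absurd (by exact_mod_cast h) (hsub _ ⟨1, by simp⟩)
  have hAz : ∀ n, A n = 0 := by
    intro n
    rcases Int.even_or_odd n with h | h
    · rw [hA0 n h, hz0]
    · rw [hA1 n h, hz1]
  have := hpt x hx
  simp only [hAz, zero_mul, mul_zero] at this
  exact this.unique hasSum_zero

lemma nonvanish_of_ode {D Q : ℂ → ℂ} {p : ℂ} (hD : AnalyticAt ℂ D p) (hQ : ContinuousAt Q p)
    (hE : ∀ᶠ z in nhds p, D z * deriv (deriv D) z - deriv D z ^ 2 + Q z * D z ^ 2 = 0)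
    (hne : ¬ ∀ᶠ z in nhds p, D z = 0) : D p ≠ 0 := by
  obtain ⟨n, u, hu, hup, hDu⟩ := hD.exists_eventuallyEq_pow_smul_nonzero_iff.mpr hne
  simp only [smul_eq_mul] at hDu
  intro hp0
  rcases n with _ | m
  · apply hup
    have := hDu.self_of_nhds
    simpa [hp0] using this.symm
  set v : ℂ → ℂ := fun z => (m + 1) * u z + (z - p) * deriv u z with hv
  have hva : AnalyticAt ℂ v p := by
    have := hu.deriv
    simp only [hv]; fun_prop
  have h1 : ∀ᶠ z in nhds p, deriv D z = (z - p) ^ m * v z := by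
    filter_upwards [hDu.eventually_nhds, hu.eventually_analyticAt] with z hz huz
    have h2 : D =ᶠ[nhds z] fun z => (z - p) ^ (m + 1) * u z := hz
    rw [h2.deriv_eq]
    have h3 : HasDerivAt (fun z => (z - p) ^ (m + 1) * u z)
        (((m + 1 : ℕ) * (z - p) ^ m * 1) * u z + (z - p) ^ (m + 1) * deriv u z) z := by
      have := ((hasDerivAt_id z).sub_const p).fun_pow (m + 1)
      exact this.mul huz.differentiableAt.hasDerivAt
    rw [h3.deriv, hv]; push_cast; ring
  have h2 : ∀ᶠ z in nhds p, (z - p) * deriv (deriv D) z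
      = (z - p) ^ m * (m * v z + (z - p) * deriv v z) := by
    filter_upwards [h1.eventually_nhds, hva.eventually_analyticAt] with z hz huz
    have h2 : deriv D =ᶠ[nhds z] fun z => (z - p) ^ m * v z := hz
    rw [h2.deriv_eq]
    have h3 : HasDerivAt (fun z => (z - p) ^ m * v z)
        ((m * (z - p) ^ (m - 1) * 1) * v z + (z - p) ^ m * deriv v z) z := by
      have := ((hasDerivAt_id z).sub_const p).fun_pow m
      exact this.mul huz.differentiableAt.hasDerivAt
    rw [h3.deriv]
    rcases m with _ | k
    · simp
    · simp; ring
  have h3 : ∀ᶠ z in nhdsWithin p {p}ᶜ,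
      u z * (m * v z + (z - p) * deriv v z) - v z ^ 2 + Q z * (z - p) ^ 2 * u z ^ 2 = 0 := by
    filter_upwards [h1.filter_mono nhdsWithin_le_nhds, h2.filter_mono nhdsWithin_le_nhds,
      hE.filter_mono nhdsWithin_le_nhds, hDu.filter_mono nhdsWithin_le_nhds,
      self_mem_nhdsWithin] with z a b c d e
    have e' : z - p ≠ 0 := sub_ne_zero.mpr e
    have h : ((z - p) ^ m) ^ 2 * (u z * (m * v z + (z - p) * deriv v z) - v z ^ 2
      + Q z * (z - p) ^ 2 * u z ^ 2) = 0 := by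
      rw [d, a] at c
      rw [← c]
      linear_combination (-(z - p) ^ m * u z) * b
    exact (mul_eq_zero.mp h).resolve_left (by positivity)
  have hc : ContinuousAt (fun z => u z * (m * v z + (z - p) * deriv v z) - v z ^ 2
      + Q z * (z - p) ^ 2 * u z ^ 2) p := by
    have := hu.continuousAt
    have := hva.continuousAt
    have := hva.deriv.continuousAt
    fun_prop
  have h4 := tendsto_nhds_unique (hc.tendsto.mono_left (nhdsWithin_le_nhds (s := {p}ᶜ)))
    ((Filter.tendsto_congr' h3).mpr tendsto_const_nhds)
  simp [hv] at h4
  have h5 : -((m : ℂ) + 1) * u p ^ 2 = 0 := by linear_combination h4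
  have : (m : ℂ) + 1 ≠ 0 := by exact_mod_cast Nat.succ_ne_zero m
  simp [hup, this, -neg_add_rev] at h5

noncomputable def DD (r : ℝ) : ℂ → ℂ := dslope (Theta r) 0

lemma theta_zero (r : ℝ) : Theta r 0 = 0 := by
  have := theta_neg r 0
  simp only [neg_zero] at this
  exact CharZero.eq_neg_self_iff.mp this

lemma theta_mul (r : ℝ) (z : ℂ) : Theta r z = z * DD r z := by
  have := sub_smul_dslope (Theta r) 0 z
  simp [theta_zero] at this
  exact this.symm

lemma DD_diff {r : ℝ} (hr : 0 < r) : Differentiable ℂ (DD r) := by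
  have := (Complex.differentiableOn_dslope (f := Theta r) (c := 0) (s := Set.univ)
    Filter.univ_mem).mpr (theta_differentiable r hr).differentiableOn
  exact differentiableOn_univ.mp this

lemma deriv_diff {f : ℂ → ℂ} (hf : Differentiable ℂ f) : Differentiable ℂ (deriv f) := by
  have := hf.differentiableOn.deriv (s := Set.univ) isOpen_univ
  exact differentiableOn_univ.mp this

lemma DD_even {r : ℝ} (hr : 0 < r) (z : ℂ) : DD r (-z) = DD r z := by
  by_cases h : z = 0
  · simp [h]
  · have h1 := theta_mul r z
    have h2 := theta_mul r (-z)
    rw [theta_neg, h1] at h2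
    exact (mul_left_cancel₀ h (by linear_combination -h2)).symm

lemma dDD_zero {r : ℝ} (hr : 0 < r) : deriv (DD r) 0 = 0 := by
  have h := deriv_comp_neg (DD r) 0
  have h2 : (fun x => DD r (-x)) = DD r := funext (DD_even hr)
  rw [h2, neg_zero] at h
  exact CharZero.eq_neg_self_iff.mp h

lemma theta_d {r : ℝ} (hr : 0 < r) (z : ℂ) :
    deriv (Theta r) z = DD r z + z * deriv (DD r) z := by
  have h2 : Theta r = fun z => z * DD r z := funext (theta_mul r)
  rw [h2]
  have := (hasDerivAt_id z).mul (DD_diff hr z).hasDerivAt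
  have h := this.deriv
  simp only [id, one_mul] at h
  exact h

lemma theta_dd {r : ℝ} (hr : 0 < r) (z : ℂ) :
    deriv (deriv (Theta r)) z = 2 * deriv (DD r) z + z * deriv (deriv (DD r)) z := by
  have h2 : deriv (Theta r) = fun z => DD r z + z * deriv (DD r) z := funext (theta_d hr)
  rw [h2]
  have := (DD_diff hr z).hasDerivAt.add
    ((hasDerivAt_id z).mul (deriv_diff (DD_diff hr) z).hasDerivAt)
  have h := this.deriv
  simp only [id, one_mul] at h
  refine Eq.trans h ?_
  ring

lemma dtheta_add (r : ℝ) (z : ℂ) :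
    deriv (Theta r) (z + 2 * Real.pi) = - deriv (Theta r) z := by
  rw [← deriv_comp_add_const]
  have : (fun x => Theta r (x + 2 * Real.pi)) = fun x => - Theta r x :=
    funext (theta_add_two_pi r)
  rw [this, deriv.fun_neg]

lemma ddtheta_add (r : ℝ) (z : ℂ) :
    deriv (deriv (Theta r)) (z + 2 * Real.pi) = - deriv (deriv (Theta r)) z := by
  rw [← deriv_comp_add_const]
  have : (fun x => deriv (Theta r) (x + 2 * Real.pi)) = fun x => - deriv (Theta r) x :=
    funext (dtheta_add r)
  rw [this, deriv.fun_neg]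

lemma hasDeriv_M (r : ℝ) (z : ℂ) :
    HasDerivAt (fun z => -Complex.exp (r - I * z)) (I * Complex.exp (r - I * z)) z := by
  have := (((hasDerivAt_id z).const_mul I).const_sub (r : ℂ)).cexp.neg
  exact this.congr_deriv (by simp only [id]; ring)

lemma dtheta_add_ir {r : ℝ} (hr : 0 < r) (z : ℂ) :
    deriv (Theta r) (z + 2 * I * r) =
      -Complex.exp (r - I * z) * (deriv (Theta r) z - I * Theta r z) := by
  rw [← deriv_comp_add_const]
  have : (fun x => Theta r (x + 2 * I * r)) = fun x => -Complex.exp (r - I * x) * Theta r x :=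
    funext (theta_add_ir r)
  rw [this]
  have := (hasDeriv_M r z).mul (theta_differentiable r hr z).hasDerivAt
  refine this.deriv.trans ?_
  ring

lemma ddtheta_add_ir {r : ℝ} (hr : 0 < r) (z : ℂ) :
    deriv (deriv (Theta r)) (z + 2 * I * r) =
      -Complex.exp (r - I * z) * (deriv (deriv (Theta r)) z - 2 * I * deriv (Theta r) z
        - Theta r z) := by
  rw [← deriv_comp_add_const]
  have : (fun x => deriv (Theta r) (x + 2 * I * r)) =
    fun x => -Complex.exp (r - I * x) * (deriv (Theta r) x - I * Theta r x) :=
    funext (dtheta_add_ir hr)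
  rw [this]
  have := (hasDeriv_M r z).mul ((deriv_diff (theta_differentiable r hr) z).hasDerivAt.sub
    ((theta_differentiable r hr z).hasDerivAt.const_mul I))
  refine this.deriv.trans ?_
  simp only [Pi.sub_apply]
  linear_combination (-Complex.exp (r - I * z) * Theta r z) * I_sq

lemma dtheta_pi (r : ℝ) : deriv (Theta r) Real.pi = 0 := by
  have h := dtheta_add r (-Real.pi)
  have h2 := deriv_comp_neg (Theta r) (Real.pi : ℂ)
  have h3 : (fun x => Theta r (-x)) = fun x => - Theta r x := funext (theta_neg r)
  rw [h3, deriv.fun_neg] at h2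
  have h4 : (-Real.pi + 2 * Real.pi : ℂ) = Real.pi := by ring
  rw [h4] at h
  have h5 : deriv (Theta r) Real.pi = - deriv (Theta r) Real.pi := by
    linear_combination h - h2
  exact CharZero.eq_neg_self_iff.mp h5

noncomputable def cc (r : ℝ) (hr : 0 < r) : ℂ :=
  -(DD r Real.pi * deriv (deriv (DD r)) Real.pi - deriv (DD r) Real.pi ^ 2) / DD r Real.pi ^ 2
    - (LL r hr).weierstrassPExcept 0 Real.pi

noncomputable def EE (r : ℝ) (hr : 0 < r) (z : ℂ) : ℂ :=
  DD r z * deriv (deriv (DD r)) z - deriv (DD r) z ^ 2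
    + (cc r hr + (LL r hr).weierstrassPExcept 0 z) * DD r z ^ 2

lemma pi_ne : (Real.pi : ℂ) ≠ 0 := by exact_mod_cast Real.pi_ne_zero

lemma DD_pi_ne {r : ℝ} (hr : 0 < r) : DD r Real.pi ≠ 0 := by
  have := theta_pi_ne r hr
  rw [theta_mul] at this
  exact right_ne_zero_of_mul this

lemma EE_pi {r : ℝ} (hr : 0 < r) : EE r hr Real.pi = 0 := by
  have := DD_pi_ne hr
  unfold EE cc
  field_simp
  ring

lemma EE_analytic {r : ℝ} (hr : 0 < r) : AnalyticOnNhd ℂ (EE r hr) (UU r) := by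
  intro z hz
  have h1 := (DD_diff hr).analyticAt z
  have h2 := h1.deriv
  have h3 := h2.deriv
  have h4 := P0_analytic hr z hz
  unfold EE
  fun_prop

noncomputable def FF (r : ℝ) (hr : 0 < r) (z : ℂ) : ℂ := z ^ 2 * EE r hr z

lemma FF_eq {r : ℝ} (hr : 0 < r) {z : ℂ} (hz : z ≠ 0) : FF r hr z =
    deriv (deriv (Theta r)) z * Theta r z - deriv (Theta r) z ^ 2
      + (cc r hr + (LL r hr).weierstrassP z) * Theta r z ^ 2 := by
  rw [← P0_eq, theta_dd hr, theta_d hr, theta_mul r z, FF, EE]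
  field_simp
  ring

lemma FF_add {r : ℝ} (hr : 0 < r) {z : ℂ} (hz : z ≠ 0) (hz' : z + 2 * Real.pi ≠ 0) :
    FF r hr (z + 2 * Real.pi) = FF r hr z := by
  rw [FF_eq hr hz, FF_eq hr hz', ddtheta_add, dtheta_add, theta_add_two_pi, P_add]
  ring

lemma FF_add_ir {r : ℝ} (hr : 0 < r) {z : ℂ} (hz : z ≠ 0) (hz' : z + 2 * I * r ≠ 0) :
    FF r hr (z + 2 * I * r) = Complex.exp (r - I * z) ^ 2 * FF r hr z := by
  rw [FF_eq hr hz, FF_eq hr hz', ddtheta_add_ir hr, dtheta_add_ir hr, theta_add_ir, P_add']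
  linear_combination (-Complex.exp (r - I * z) ^ 2 * Theta r z ^ 2) * I_sq

lemma FF_zero {r : ℝ} (hr : 0 < r) (x : ℝ) (hx : x ∈ Set.Ico (-Real.pi) Real.pi) :
    FF r hr x = 0 := by
  have hpi := Real.pi_pos
  refine fourier_zero_aux hr (F := FF r hr) ?_ ?_ ?_ (by simp [FF]) (by simp [FF, EE_pi]) x hx
  · intro z hz
    unfold FF
    have := (EE_analytic hr z hz).differentiableAt
    exact DifferentiableAt.differentiableWithinAt (by fun_prop)
  · intro y hy
    have h := FF_add hr (z := -Real.pi + y * I) ?_ ?_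
    · rw [← h]; congr 1; ring
    · intro h
      have := congrArg Complex.re h
      simp at this
    · intro h
      have := congrArg Complex.re h
      simp at this
      linarith
  · intro x hx
    have h := FF_add_ir hr (z := x + (-r : ℝ) * I) ?_ ?_
    · have e : (x + (-r : ℝ) * I + 2 * I * r : ℂ) = x + r * I := by push_cast; ring
      rw [e] at h
      rw [h, ← Complex.exp_nat_mul]
      congr 2
      push_cast
      linear_combination (2 * r) * I_sq
    · intro h
      have := congrArg Complex.im h
      simp at this
      exact hr.ne' this
    · intro h
      have := congrArg Complex.im h
      simp at this
      linarith

lemma EE_zero {r : ℝ} (hr : 0 < r) {z : ℂ} (hz : z ∈ UU r) : EE r hr z = 0 := by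
  have h := (EE_analytic hr).eqOn_zero_of_preconnected_of_frequently_eq_zero
    (convex_UU r).isPreconnected (zero_mem_UU hr) ?_
  · exact h hz
  have h1 : Filter.Tendsto (fun x : ℝ => (x : ℂ)) (nhdsWithin 0 {0}ᶜ) (nhdsWithin 0 {0}ᶜ) := by
    refine tendsto_nhdsWithin_of_tendsto_nhds_of_eventually_within _ ?_ ?_
    · have : Filter.Tendsto (fun x : ℝ => (x : ℂ)) (nhds 0) (nhds ((0 : ℝ) : ℂ)) :=
        Complex.continuous_ofReal.tendsto 0
      rw [Complex.ofReal_zero] at this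
      exact this.mono_left nhdsWithin_le_nhds
    · filter_upwards [self_mem_nhdsWithin] with x hx
      simpa using hx
  refine h1.frequently (Filter.Eventually.frequently ?_)
  have h2 : Set.Ico (-Real.pi) Real.pi ∈ nhds (0 : ℝ) :=
    Ico_mem_nhds (by linarith [Real.pi_pos]) Real.pi_pos
  filter_upwards [self_mem_nhdsWithin, nhdsWithin_le_nhds h2] with x hx hx2
  have h3 := FF_zero hr x hx2
  have hx' : (x : ℂ) ≠ 0 := by simpa using hx
  rw [FF] at h3
  exact (mul_eq_zero.mp h3).resolve_left (pow_ne_zero 2 hx')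

lemma DD_ne {r : ℝ} (hr : 0 < r) {z : ℂ} (hz : z ∈ UU r) : DD r z ≠ 0 := by
  refine nonvanish_of_ode (Q := fun z => cc r hr + (LL r hr).weierstrassPExcept 0 z)
    ((DD_diff hr).analyticAt z) ?_ ?_ ?_
  · have := (P0_analytic hr z hz).continuousAt
    fun_prop
  · filter_upwards [(isOpen_UU r).mem_nhds hz] with w hw
    exact EE_zero hr hw
  · intro h
    have h1 : AnalyticOnNhd ℂ (DD r) Set.univ := fun z _ => (DD_diff hr).analyticAt z
    exact DD_pi_ne hr (h1.eqOn_zero_of_preconnected_of_eventuallyEq_zero isPreconnected_univ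
      (Set.mem_univ z) h (Set.mem_univ _))

noncomputable def lam (r : ℝ) (z : ℂ) : ℂ := deriv (DD r) z / DD r z

lemma lam_hasDeriv {r : ℝ} (hr : 0 < r) {z : ℂ} (hz : z ∈ UU r) :
    HasDerivAt (lam r) (-(cc r hr + (LL r hr).weierstrassPExcept 0 z)) z := by
  have h := (deriv_diff (DD_diff hr) z).hasDerivAt.div (DD_diff hr z).hasDerivAt (DD_ne hr hz)
  refine h.congr_deriv ?_
  have h0 := DD_ne hr hz
  have h1 := EE_zero hr hz
  unfold EE at h1
  field_simp
  linear_combination h1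

lemma lam_zero {r : ℝ} (hr : 0 < r) : lam r 0 = 0 := by
  simp [lam, dDD_zero hr]

lemma lam_eq {r : ℝ} (hr : 0 < r) {z : ℂ} (hz : z ∈ UU r) :
    lam r z + cc r hr * z - wz0 r z = 0 := by
  have hd : ∀ w ∈ UU r, HasDerivAt (fun z => lam r z + cc r hr * z - wz0 r z) 0 w := by
    intro w hw
    have := ((lam_hasDeriv hr hw).add ((hasDerivAt_id w).const_mul (cc r hr))).sub
      (wz0_hasDerivAt hr hw)
    exact this.congr_deriv (by ring)
  have h := (isOpen_UU r).is_const_of_deriv_eq_zero (convex_UU r).isPreconnected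
    (fun w hw => (hd w hw).differentiableAt.differentiableWithinAt)
    (fun w hw => (hd w hw).deriv) hz (zero_mem_UU hr)
  simpa [lam_zero hr, wz0_zero] using h

lemma pi_mem {r : ℝ} (hr : 0 < r) : (Real.pi : ℂ) ∈ UU r := by
  rw [mem_UU]
  have := Real.pi_pos
  constructor
  · rw [Complex.ofReal_re, abs_of_pos this]; linarith
  · simp; linarith

lemma wzeta_pi {r : ℝ} (hr : 0 < r) : wzeta r Real.pi / Real.pi = cc r hr := by
  have h := lam_eq hr (pi_mem hr)
  have h1 : lam r Real.pi = - 1 / Real.pi := by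
    have h2 := theta_d hr Real.pi
    rw [dtheta_pi] at h2
    have := DD_pi_ne hr
    have := pi_ne
    unfold lam
    field_simp
    linear_combination -h2
  have h3 : wzeta r Real.pi = 1 / Real.pi + wz0 r Real.pi := rfl
  have := pi_ne
  rw [div_eq_iff this, h3]
  linear_combination h1 - h

lemma Hker_eq {r : ℝ} (hr : 0 < r) {z : ℂ} (hz : z ∈ UU r) (h0 : z ≠ 0) :
    Hker r z = 2 / z + 2 * lam r z := by
  have := DD_ne hr hz
  rw [Hker, theta_d hr, theta_mul r z, lam]
  field_simp

lemma lam_analytic {r : ℝ} (hr : 0 < r) : AnalyticAt ℂ (lam r) 0 :=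
  ((DD_diff hr).analyticAt 0).deriv.div ((DD_diff hr).analyticAt 0) (DD_ne hr (zero_mem_UU hr))

/-- Local expansion of the Loewner kernel at the origin. -/
theorem H_expansion_at_zero (r : ℝ) (hr : 0 < r) :
    ∃ ε > 0, ∃ g : ℂ → ℂ, AnalyticOnNhd ℂ g (Metric.ball 0 ε) ∧
      (∀ z ∈ Metric.ball (0 : ℂ) ε, z ≠ 0 →
        Hker r z = 2 / z - (2 * wzeta r (Real.pi : ℂ) / (Real.pi : ℂ)) * z
          + z ^ 3 * g z) ∧
      ∃ h : ℂ → ℂ, AnalyticAt ℂ h 0 ∧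
        (∀ z ∈ Metric.ball (0 : ℂ) ε, z ≠ 0 → h z = Hker r z - 2 / z) ∧
        h 0 = 0 ∧
        deriv h 0 = -(2 * wzeta r (Real.pi : ℂ) / (Real.pi : ℂ)) ∧
        deriv (deriv h) 0 = 0 := by
  have hU := (isOpen_UU r).mem_nhds (zero_mem_UU hr)
  have hla := lam_analytic hr
  have hP := P0_analytic hr 0 (zero_mem_UU hr)
  have hdP : HasDerivAt ((LL r hr).weierstrassPExcept 0) 0 0 := by
    have h := hP.differentiableAt.hasDerivAt
    have h2 := deriv_comp_neg ((LL r hr).weierstrassPExcept 0) 0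
    have h3 : (fun x => (LL r hr).weierstrassPExcept 0 (-x)) = (LL r hr).weierstrassPExcept 0 := by
      funext x
      simpa using (LL r hr).weierstrassPExcept_neg 0 x
    rw [h3, neg_zero] at h2
    rwa [CharZero.eq_neg_self_iff.mp h2] at h
  rw [mul_div_assoc, wzeta_pi hr]
  -- derivatives of `k = 2 λ + 2 a z`
  have key : ∀ a : ℂ, (deriv (fun z => 2 * lam r z + 2 * a * z) 0 = 2 * a - 2 * cc r hr) ∧
      deriv (deriv (fun z => 2 * lam r z + 2 * a * z)) 0 = 0 := by
    intro a
    have h1 : ∀ z ∈ UU r, deriv (fun z => 2 * lam r z + 2 * a * z) z =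
        2 * a - 2 * (cc r hr + (LL r hr).weierstrassPExcept 0 z) := by
      intro z hz
      have := ((lam_hasDeriv hr hz).const_mul 2).add ((hasDerivAt_id z).const_mul (2 * a))
      exact this.deriv.trans (by ring)
    refine ⟨by rw [h1 0 (zero_mem_UU hr)]; simp, ?_⟩
    have h2 : deriv (fun z => 2 * lam r z + 2 * a * z) =ᶠ[nhds 0]
        fun z => 2 * a - 2 * (cc r hr + (LL r hr).weierstrassPExcept 0 z) :=
      Filter.mem_of_superset hU h1
    rw [h2.deriv_eq]
    have := ((hdP.const_add (cc r hr)).const_mul 2).const_sub (2 * a)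
    exact this.deriv.trans (by simp)
  have hka : AnalyticAt ℂ (fun z => 2 * lam r z + 2 * cc r hr * z) 0 := by fun_prop
  have ho : ((3 : ℕ) : ℕ∞) ≤ analyticOrderAt (fun z => 2 * lam r z + 2 * cc r hr * z) 0 := by
    rw [natCast_le_analyticOrderAt_iff_iteratedDeriv_eq_zero hka]
    intro i hi
    interval_cases i
    · simp [lam_zero hr]
    · rw [iteratedDeriv_one, (key _).1]; ring
    · rw [iteratedDeriv_succ, iteratedDeriv_one, (key _).2]
  obtain ⟨g, hg, hgk⟩ := (natCast_le_analyticOrderAt hka).mp ho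
  obtain ⟨ε, hε, hb⟩ := Metric.eventually_nhds_iff_ball.mp
    ((hg.eventually_analyticAt.and hgk).and hU)
  refine ⟨ε, hε, g, fun z hz => (hb z hz).1.1, ?_, fun z => 2 * lam r z, by fun_prop, ?_, ?_, ?_, ?_⟩
  · intro z hz h0
    obtain ⟨⟨_, h1⟩, h2⟩ := hb z hz
    rw [Hker_eq hr h2 h0]
    simp only [sub_zero, smul_eq_mul] at h1
    linear_combination h1
  · intro z hz h0
    rw [Hker_eq hr (hb z hz).2 h0]
    ring
  · simp [lam_zero hr]
  · have := (key 0).1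
    simpa using this
  · have := (key 0).2
    simpa using this
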